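/- Under the stated assumptions, for every 0 < ε < 1 there exist points s_1, …, s_N ∈ [t₁, t₂] with N ≤ (T² + 2c²)/(ε c²) such that for every Borel probability measure Q on continuous functions ℝ → ℝ concentrated on landscape-type functions, and every t ∈ [t₁, t₂], there is some j with (∫ |λ(t)/σ(t) − λ(s_j)/σ(s_j)|² dQ(λ))^{1/2} ≤ ε T/(2c). Hence the class G_c = {g_t : g_t(λ) = λ(t)/σ(t), t ∈ [t₁,t₂]} is of VC type with envelope T/(2c): sup_Q N(G_c, L²(Q), ε T/(2c)) ≤ a/ε with a = (T² + 2c²)/c². -/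

import Mathlib

open MeasureTheory Set

noncomputable section

/-- A landscape-type function for `T`: 1-Lipschitz, with values in `[0, T/2]`,
and vanishing outside `[0, T]`. -/
def IsLandscapeType (T : ℝ) (f : ℝ → ℝ) : Prop :=
  LipschitzWith 1 f ∧ (∀ t, 0 ≤ f t ∧ f t ≤ T / 2) ∧ ∀ t ∉ Set.Icc (0 : ℝ) T, f t = 0

/-- The Borel σ-algebra on the space `C(ℝ, ℝ)` of continuous functions with the
topology of uniform convergence on compact sets (the compact-open topology). -/
instance : MeasurableSpace C(ℝ, ℝ) := borel _

instance : BorelSpace C(ℝ, ℝ) := ⟨rfl⟩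

/-- The mean function `μ(t) = ∫ λ(t) dP(λ)`. -/
def lmean (P : Measure C(ℝ, ℝ)) (t : ℝ) : ℝ := ∫ f, f t ∂P

/-- The variance function `σ(t)² = ∫ λ(t)² dP(λ) − μ(t)²`. -/
def lvar (P : Measure C(ℝ, ℝ)) (t : ℝ) : ℝ := (∫ f, (f t) ^ 2 ∂P) - (lmean P t) ^ 2

/-- The standard deviation function `σ(t)`. -/
def lsd (P : Measure C(ℝ, ℝ)) (t : ℝ) : ℝ := Real.sqrt (lvar P t)

/-- Cauchy–Schwarz for the covariance of square-integrable random variables. -/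
lemma covariance_sq_le_variance_mul_variance {Ω : Type*} {m : MeasurableSpace Ω} {μ : Measure Ω}
    [IsFiniteMeasure μ] {X Y : Ω → ℝ} (hX : MemLp X 2 μ) (hY : MemLp Y 2 μ) :
    ProbabilityTheory.covariance X Y μ ^ 2 ≤
      ProbabilityTheory.variance X μ * ProbabilityTheory.variance Y μ := by
  have h : ∀ x : ℝ, 0 ≤ ProbabilityTheory.variance X μ * (x * x) +
      2 * ProbabilityTheory.covariance X Y μ * x + ProbabilityTheory.variance Y μ := fun x => by
    have h0 := ProbabilityTheory.variance_nonneg (x • X + Y) μ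
    rw [ProbabilityTheory.variance_add (hX.const_smul x) hY, ProbabilityTheory.variance_smul,
      ProbabilityTheory.covariance_smul_left] at h0
    linarith
  have hd := discrim_le_zero h
  rw [discrim] at hd
  linarith

/-- The standard deviation is a seminorm, so it satisfies the reverse triangle inequality. -/
lemma sq_sqrt_variance_sub_le {Ω : Type*} {m : MeasurableSpace Ω} {μ : Measure Ω}
    [IsFiniteMeasure μ] {X Y : Ω → ℝ} (hX : MemLp X 2 μ) (hY : MemLp Y 2 μ) :
    (√(ProbabilityTheory.variance X μ) - √(ProbabilityTheory.variance Y μ)) ^ 2 ≤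
      ProbabilityTheory.variance (X - Y) μ := by
  have hcov : ProbabilityTheory.covariance X Y μ ≤
      √(ProbabilityTheory.variance X μ) * √(ProbabilityTheory.variance Y μ) := by
    rw [← Real.sqrt_mul (ProbabilityTheory.variance_nonneg X μ)]
    exact Real.le_sqrt_of_sq_le (covariance_sq_le_variance_mul_variance hX hY)
  rw [ProbabilityTheory.variance_sub hX hY, sub_sq,
    Real.sq_sqrt (ProbabilityTheory.variance_nonneg X μ),
    Real.sq_sqrt (ProbabilityTheory.variance_nonneg Y μ)]
  linarith

lemma IsLandscapeType.abs_sub_le {T : ℝ} {f : ℝ → ℝ} (hf : IsLandscapeType T f) (s t : ℝ) :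
    |f s - f t| ≤ |s - t| := by
  simpa [Real.dist_eq] using hf.1.dist_le_mul s t

lemma isClosed_setOf_isLandscapeType (T : ℝ) : IsClosed {f : C(ℝ, ℝ) | IsLandscapeType T f} := by
  have heval (t : ℝ) : Continuous fun f : C(ℝ, ℝ) => f t := continuous_eval_const t
  simp only [IsLandscapeType, lipschitzWith_iff_dist_le_mul, ofPred_and, ofPred_forall]
  refine IsClosed.inter ?_ (IsClosed.inter ?_ ?_)
  · exact isClosed_iInter fun x => isClosed_iInter fun y =>
      isClosed_le ((heval x).dist (heval y)) continuous_const
  · exact isClosed_iInter fun t =>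
      (isClosed_le continuous_const (heval t)).inter (isClosed_le (heval t) continuous_const)
  · exact isClosed_iInter fun t => isClosed_iInter fun _ => isClosed_eq (heval t) continuous_const

lemma ae_isLandscapeType {T : ℝ} {P : Measure C(ℝ, ℝ)} [IsProbabilityMeasure P]
    (hP : P {f | IsLandscapeType T f} = 1) : ∀ᵐ f : C(ℝ, ℝ) ∂P, IsLandscapeType T f :=
  (mem_ae_iff_prob_eq_one (isClosed_setOf_isLandscapeType T).measurableSet).2 hP

lemma memLp_eval {T : ℝ} {P : Measure C(ℝ, ℝ)} [IsProbabilityMeasure P]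
    (hP : ∀ᵐ f : C(ℝ, ℝ) ∂P, IsLandscapeType T f) (t : ℝ) : MemLp (fun f : C(ℝ, ℝ) => f t) 2 P := by
  refine MemLp.of_bound (continuous_eval_const t).measurable.aestronglyMeasurable (T / 2) ?_
  filter_upwards [hP] with f hf
  rw [Real.norm_eq_abs, abs_of_nonneg (hf.2.1 t).1]
  exact (hf.2.1 t).2

lemma lsd_eq_sqrt_variance {T : ℝ} {P : Measure C(ℝ, ℝ)} [IsProbabilityMeasure P]
    (hP : ∀ᵐ f : C(ℝ, ℝ) ∂P, IsLandscapeType T f) (t : ℝ) :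
    lsd P t = √(ProbabilityTheory.variance (fun f : C(ℝ, ℝ) => f t) P) := by
  rw [lsd, ProbabilityTheory.variance_eq_sub (memLp_eval hP t)]
  rfl

lemma lsd_le {T : ℝ} (hT : 0 ≤ T) {P : Measure C(ℝ, ℝ)} [IsProbabilityMeasure P]
    (hP : ∀ᵐ f : C(ℝ, ℝ) ∂P, IsLandscapeType T f) (t : ℝ) : lsd P t ≤ T / 4 := by
  rw [lsd_eq_sqrt_variance hP]
  refine Real.sqrt_le_iff.2 ⟨by positivity, ?_⟩
  have h := ProbabilityTheory.variance_le_sq_of_bounded (a := 0) (b := T / 2)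
    (hP.mono fun f hf => hf.2.1 t) (memLp_eval hP t).aemeasurable
  calc _ ≤ _ := h
    _ = _ := by ring

lemma abs_lsd_sub_le {T : ℝ} {P : Measure C(ℝ, ℝ)} [IsProbabilityMeasure P]
    (hP : ∀ᵐ f : C(ℝ, ℝ) ∂P, IsLandscapeType T f) (s t : ℝ) : |lsd P s - lsd P t| ≤ |s - t| := by
  refine sq_le_sq.1 ?_
  rw [lsd_eq_sqrt_variance hP, lsd_eq_sqrt_variance hP]
  refine (sq_sqrt_variance_sub_le (memLp_eval hP s) (memLp_eval hP t)).trans ?_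
  have h := ProbabilityTheory.variance_le_sq_of_bounded (a := -|s - t|) (b := |s - t|)
    (hP.mono fun f hf => abs_le.1 (hf.abs_sub_le s t))
    ((memLp_eval hP s).sub (memLp_eval hP t)).aemeasurable
  calc _ ≤ _ := h
    _ = |s - t| ^ 2 := by ring
    _ = _ := sq_abs _

/-- A quotient of a bounded Lipschitz quantity by a Lipschitz quantity bounded below. -/
lemma abs_div_sub_div_le {a b p q c d M : ℝ} (hc : 0 < c) (hp : c ≤ p) (hq : c ≤ q)
    (hb : |b| ≤ M) (hab : |a - b| ≤ d) (hpq : |p - q| ≤ d) :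
    |a / p - b / q| ≤ d * (c + M) / c ^ 2 := by
  have hp0 : 0 < p := hc.trans_le hp
  have hq0 : 0 < q := hc.trans_le hq
  have hd : 0 ≤ d := (abs_nonneg _).trans hab
  have hM : 0 ≤ M := (abs_nonneg _).trans hb
  have hsplit : a / p - b / q = (a - b) / p + b * (q - p) / (p * q) := by
    field_simp
    ring
  have h₁ : |(a - b) / p| ≤ d / c := by
    rw [abs_div, abs_of_pos hp0]
    gcongr
  have h₂ : |b * (q - p) / (p * q)| ≤ M * d / (c * c) := by
    rw [abs_div, abs_mul, abs_sub_comm, abs_of_pos (mul_pos hp0 hq0)]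
    gcongr
  calc |a / p - b / q| ≤ |(a - b) / p| + |b * (q - p) / (p * q)| := by
        rw [hsplit]
        exact abs_add_le _ _
    _ ≤ d / c + M * d / (c * c) := add_le_add h₁ h₂
    _ = d * (c + M) / c ^ 2 := by
        field_simp

/-- A compact interval `[a, b]` has a `δ`-net with at most `(b - a) / (2 δ) + 1` points. -/
lemma exists_net_Icc {a b δ : ℝ} (hab : a ≤ b) (hδ : 0 < δ) :
    ∃ (N : ℕ) (s : Fin N → ℝ), (N : ℝ) ≤ (b - a) / (2 * δ) + 1 ∧ (∀ j, s j ∈ Icc a b) ∧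
      ∀ t ∈ Icc a b, ∃ j, |t - s j| ≤ δ := by
  refine ⟨⌊(b - a) / (2 * δ)⌋₊ + 1, fun j => min b (a + (2 * (j : ℕ) + 1) * δ), ?_, ?_, ?_⟩
  · push_cast
    gcongr
    exact Nat.floor_le (div_nonneg (sub_nonneg.2 hab) (by positivity))
  · refine fun j => ⟨le_min hab ?_, min_le_left _ _⟩
    have : 0 ≤ (2 * ((j : ℕ) : ℝ) + 1) * δ := by positivity
    linarith
  · rintro t ⟨hat, htb⟩
    refine ⟨⟨⌊(t - a) / (2 * δ)⌋₊, Nat.lt_succ_of_le (Nat.floor_mono (by gcongr))⟩, ?_⟩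
    have hlo := Nat.floor_le (div_nonneg (sub_nonneg.2 hat) (by positivity : 0 ≤ 2 * δ))
    have hhi := Nat.lt_floor_add_one ((t - a) / (2 * δ))
    rw [le_div_iff₀ (by positivity)] at hlo
    rw [div_lt_iff₀ (by positivity)] at hhi
    dsimp only
    rw [abs_le]
    constructor
    · linarith [min_le_right b (a + (2 * (⌊(t - a) / (2 * δ)⌋₊ : ℝ) + 1) * δ)]
    · have : t - δ ≤ min b (a + (2 * (⌊(t - a) / (2 * δ)⌋₊ : ℝ) + 1) * δ) :=
        le_min (by linarith) (by linarith)
      linarith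

/-- If `σ(t) ≥ c > 0` on `[t₁, t₂] ⊆ [0, T]`, then for every `0 < ε < 1` there are points
`s_1, …, s_N ∈ [t₁, t₂]` with `N ≤ (T² + 2c²)/(ε c²)` such that for every Borel probability
measure `Q` concentrated on landscape-type functions and every `t ∈ [t₁, t₂]` some `s_j`
satisfies `(∫ |λ(t)/σ(t) − λ(s_j)/σ(s_j)|² dQ)^{1/2} ≤ ε T/(2c)`.  Hence the class
`G_c = {g_t : t ∈ [t₁,t₂]}`, `g_t(λ) = λ(t)/σ(t)`, is of VC type with envelope `T/(2c)`:
`sup_Q N(G_c, L²(Q), εT/(2c)) ≤ a/ε` with `a = (T² + 2c²)/c²`. -/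
theorem standardized_class_net (T : ℝ) (hT : 0 < T)
    (P : Measure C(ℝ, ℝ)) [IsProbabilityMeasure P]
    (hP : P {f | IsLandscapeType T f} = 1)
    (t₁ t₂ c : ℝ) (ht₁ : 0 ≤ t₁) (h₁₂ : t₁ < t₂) (ht₂ : t₂ ≤ T) (hc : 0 < c)
    (hσ : ∀ t ∈ Icc t₁ t₂, c ≤ lsd P t)
    (ε : ℝ) (hε0 : 0 < ε) (hε1 : ε < 1) :
    ∃ (N : ℕ) (s : Fin N → ℝ), (N : ℝ) ≤ (T ^ 2 + 2 * c ^ 2) / (ε * c ^ 2) ∧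
      (∀ j, s j ∈ Icc t₁ t₂) ∧
      ∀ Q : Measure C(ℝ, ℝ), IsProbabilityMeasure Q →
        Q {f | IsLandscapeType T f} = 1 →
        ∀ t ∈ Icc t₁ t₂, ∃ j,
          Real.sqrt (∫ f, |f t / lsd P t - f (s j) / lsd P (s j)| ^ 2 ∂Q)
            ≤ ε * T / (2 * c) := by
  have hPae := ae_isLandscapeType hP
  have hcT : c ≤ T / 4 := (hσ t₁ (left_mem_Icc.2 h₁₂.le)).trans (lsd_le hT.le hPae t₁)
  obtain ⟨N, s, hN, hs, hnet⟩ := exists_net_Icc (δ := ε * T * c / (2 * c + T)) h₁₂.le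
    (by positivity)
  refine ⟨N, s, hN.trans ?_, hs, fun Q _ hQ t ht => ?_⟩
  · have hratio : T / (2 * c) ≤ T ^ 2 / c ^ 2 := by
      rw [div_le_div_iff₀ (by positivity) (by positivity)]
      nlinarith [mul_pos hT hc, mul_le_mul_of_nonneg_left hcT (mul_pos hT hc).le]
    calc (t₂ - t₁) / (2 * (ε * T * c / (2 * c + T))) + 1
        ≤ T / (2 * (ε * T * c / (2 * c + T))) + 1 / ε := by
          gcongr
          · linarith
          · exact (one_le_div hε0).2 hε1.le
      _ = (2 + T / (2 * c)) / ε := by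
          field_simp
          ring
      _ ≤ (2 + T ^ 2 / c ^ 2) / ε := by gcongr
      _ = (T ^ 2 + 2 * c ^ 2) / (ε * c ^ 2) := by
          field_simp
          ring
  · obtain ⟨j, hj⟩ := hnet t ht
    refine ⟨j, Real.sqrt_le_iff.2 ⟨by positivity, ?_⟩⟩
    refine (le_abs_self _).trans ?_
    have hbound : ∀ᵐ f ∂Q, ‖|f t / lsd P t - f (s j) / lsd P (s j)| ^ 2‖ ≤
        (ε * T / (2 * c)) ^ 2 := by
      filter_upwards [ae_isLandscapeType hQ] with f hf
      rw [norm_pow, Real.norm_eq_abs, abs_abs]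
      gcongr
      have hfs : |f (s j)| ≤ T / 2 := by
        rw [abs_of_nonneg (hf.2.1 _).1]
        exact (hf.2.1 _).2
      refine (abs_div_sub_div_le hc (hσ t ht) (hσ _ (hs j)) hfs ((hf.abs_sub_le _ _).trans hj)
        ((abs_lsd_sub_le hPae _ _).trans hj)).trans_eq ?_
      field_simp
    simpa using norm_integral_le_of_norm_le_const hbound
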